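/- Let T = ℝ/2πℤ, and for x ∈ T let P(x,·) be the uniform probability distribution on the arc A_x := { x + u (mod 2π) : u ∈ [−2, 2] }. Then there is no probability space (Ω, F, ℙ) together with a jointly measurable map φ : T × Ω → T such that (i) for every x ∈ T the law of ω ↦ φ(x, ω) equals P(x,·), and (ii) for every x ≠ y in T, ℙ( φ(x,·) ≠ φ(y,·) ) < 2/3. Equivalently, for the discrete metric d on T (d(x,y) = 1 if x ≠ y, 0 otherwise), no random-function representation φ of the kernel P satisfies E[ d(φ(x,ξ), φ(y,ξ)) ] < (2/3) d(x,y) for all x, y. -/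

import Mathlib

open MeasureTheory

instance : Fact (0 < 2 * Real.pi) := ⟨by positivity⟩

/-- The arc `A_x = {x + u (mod 2π) : u ∈ [−2, 2]}` of length 4 on the circle `ℝ/2πℤ`. -/
noncomputable def arc (x : AddCircle (2 * Real.pi)) : Set (AddCircle (2 * Real.pi)) :=
  (fun u : ℝ => x + (u : AddCircle (2 * Real.pi))) '' Set.Icc (-2) 2

/-- If `y ∈ A_a ∩ A_{a + 2π/3}`, then the offset of `y` from `a` exceeds its offset from
`a + 2π/3` by exactly `2π/3`. -/
lemma sub_eq_of_coe_add_eq {a u v : ℝ} (hu : u ∈ Set.Icc (-2 : ℝ) 2) (hv : v ∈ Set.Icc (-2 : ℝ) 2)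
    (h : (a : AddCircle (2 * Real.pi)) + (u : AddCircle (2 * Real.pi)) =
      ((a + 2 * Real.pi / 3 : ℝ) : AddCircle (2 * Real.pi)) + (v : AddCircle (2 * Real.pi))) :
    u - v = 2 * Real.pi / 3 := by
  have hpi := Real.pi_gt_three
  rw [← AddCircle.coe_add, ← AddCircle.coe_add, ← sub_eq_zero, ← AddCircle.coe_sub,
    AddCircle.coe_eq_zero_iff] at h
  obtain ⟨n, hn⟩ := h
  rw [zsmul_eq_mul] at hn
  obtain ⟨hu₁, hu₂⟩ := hu
  obtain ⟨hv₁, hv₂⟩ := hv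
  have hn_lt : n < 1 := by
    by_contra! h1
    have h1' : (1 : ℝ) ≤ n := by exact_mod_cast h1
    nlinarith
  have hn_gt : -1 < n := by
    by_contra! h1
    have h1' : (n : ℝ) ≤ -1 := by exact_mod_cast h1
    nlinarith
  obtain rfl : n = 0 := by omega
  push_cast at hn
  linarith

/-- The three arcs centred at `0`, `2π/3` and `4π/3` have no common point. -/
lemma notMem_arc_inter {y : AddCircle (2 * Real.pi)}
    (h₀ : y ∈ arc ((0 : ℝ) : AddCircle (2 * Real.pi)))
    (h₁ : y ∈ arc ((0 + 2 * Real.pi / 3 : ℝ) : AddCircle (2 * Real.pi)))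
    (h₂ : y ∈ arc ((0 + 2 * Real.pi / 3 + 2 * Real.pi / 3 : ℝ) : AddCircle (2 * Real.pi))) :
    False := by
  obtain ⟨u, hu, rfl⟩ := h₀
  obtain ⟨v, hv, hvu⟩ := h₁
  obtain ⟨w, hw, hwu⟩ := h₂
  have huv := sub_eq_of_coe_add_eq hu hv hvu.symm
  have hvw := sub_eq_of_coe_add_eq hv hw (hvu.trans hwu.symm)
  linarith [Real.pi_gt_three, hu.2, hw.1]

lemma measurableSet_arc (x : AddCircle (2 * Real.pi)) : MeasurableSet (arc x) :=
  (isCompact_Icc.image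
    (continuous_const.add (AddCircle.continuous_mk' (2 * Real.pi)))).measurableSet

lemma coe_ne_coe_of_sub_mem_Ioo {a b : ℝ} (h : b - a ∈ Set.Ioo 0 (2 * Real.pi)) :
    (a : AddCircle (2 * Real.pi)) ≠ (b : AddCircle (2 * Real.pi)) := by
  intro hab
  have := (AddCircle.coe_eq_coe_iff_of_mem_Ico (a := a) ⟨le_rfl, by linarith [Real.pi_pos]⟩
    ⟨by linarith [h.1], by linarith [h.2]⟩).1 hab
  linarith [h.1]

/-- No random-function representation `φ` of the kernel `P(x,·) = uniform on A_x` can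
contract the discrete metric by a factor `< 2/3`: there is no probability space `(Ω, ℙ)`
and jointly measurable `φ` with `φ(x,·) ∼ P(x,·)` for all `x` and
`ℙ(φ(x,·) ≠ φ(y,·)) < 2/3` for all `x ≠ y`. -/
theorem stmt_10
    (Ω : Type*) [MeasurableSpace Ω] (ℙ : Measure Ω) [IsProbabilityMeasure ℙ]
    (φ : AddCircle (2 * Real.pi) → Ω → AddCircle (2 * Real.pi))
    (hφmeas : Measurable (fun q : AddCircle (2 * Real.pi) × Ω => φ q.1 q.2))
    (hlaw : ∀ x, Measure.map (φ x) ℙ = ProbabilityTheory.cond volume (arc x))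
    (hcontr : ∀ x z, x ≠ z → ℙ {ω | φ x ω ≠ φ z ω} < 2 / 3) :
    False := by
  have hmeas (x) : Measurable (φ x) := hφmeas.comp measurable_prodMk_left
  have hmem (x) : ∀ᵐ ω ∂ℙ, φ x ω ∈ arc x := by
    refine ae_of_ae_map (hmeas x).aemeasurable ?_
    rw [hlaw x]
    exact ProbabilityTheory.ae_cond_mem (measurableSet_arc x)
  have hne (x z) : MeasurableSet {ω | φ x ω ≠ φ z ω} :=
    (measurableSet_eq_fun (hmeas x) (hmeas z)).compl
  have hpi := Real.pi_pos
  set x₀ : AddCircle (2 * Real.pi) := ((0 : ℝ) : AddCircle (2 * Real.pi))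
  set x₁ : AddCircle (2 * Real.pi) :=
    ((0 + 2 * Real.pi / 3 : ℝ) : AddCircle (2 * Real.pi))
  set x₂ : AddCircle (2 * Real.pi) :=
    ((0 + 2 * Real.pi / 3 + 2 * Real.pi / 3 : ℝ) : AddCircle (2 * Real.pi))
  have h₀₁ := hcontr x₀ x₁ (coe_ne_coe_of_sub_mem_Ioo ⟨by linarith, by linarith⟩)
  have h₁₂ := hcontr x₁ x₂ (coe_ne_coe_of_sub_mem_Ioo ⟨by linarith, by linarith⟩)
  have h₀₂ := hcontr x₀ x₂ (coe_ne_coe_of_sub_mem_Ioo ⟨by linarith, by linarith⟩)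
  have hle : (2 : ENNReal) ≤ ℙ {ω | φ x₀ ω ≠ φ x₁ ω} + ℙ {ω | φ x₁ ω ≠ φ x₂ ω} +
      ℙ {ω | φ x₀ ω ≠ φ x₂ ω} := by
    rw [← lintegral_indicator_one (hne x₀ x₁), ← lintegral_indicator_one (hne x₁ x₂),
      ← lintegral_indicator_one (hne x₀ x₂),
      ← lintegral_add_left (measurable_one.indicator (hne x₀ x₁)),
      ← lintegral_add_right _ (measurable_one.indicator (hne x₀ x₂))]
    calc (2 : ENNReal) = ∫⁻ _, 2 ∂ℙ := by simp
      _ ≤ _ := lintegral_mono_ae ?_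
    filter_upwards [hmem x₀, hmem x₁, hmem x₂] with ω h₀ h₁ h₂
    have hnot : ¬ (φ x₀ ω = φ x₁ ω ∧ φ x₀ ω = φ x₂ ω) := fun ⟨e₁, e₂⟩ =>
      notMem_arc_inter h₀ (e₁ ▸ h₁) (e₂ ▸ h₂)
    by_cases e₁ : φ x₀ ω = φ x₁ ω <;> by_cases e₂ : φ x₀ ω = φ x₂ ω <;>
      by_cases e₃ : φ x₁ ω = φ x₂ ω <;>
      simp_all [one_add_one_eq_two]
  have hlt := ENNReal.add_lt_add (ENNReal.add_lt_add h₀₁ h₁₂) h₀₂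
  refine absurd (hle.trans_lt hlt) (not_lt.mpr (le_of_eq ?_))
  rw [ENNReal.div_add_div_same, ENNReal.div_add_div_same,
    show (2 + 2 + 2 : ENNReal) = 2 * 3 by norm_num]
  exact ENNReal.mul_div_cancel_right three_ne_zero ENNReal.ofNat_ne_top
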